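/- arXiv:math/0411552 — 4 statements merged into one kernel-verified Lean document; each statement's English description precedes it below -/
import Mathlib

section
/- For every t > 0 and every z ∈ ℝ, the integral ∫₀^t (1/(2√(π(2t − 2r)))) · exp(−z²/(4(2t − 2r))) dr equals √(t/(2π)) exp(−z²/(8t)) + (z/4)·erf(z/(2√(2t))) − |z|/4, i.e. it equals F_t(z). -/
open MeasureTheory ProbabilityTheory Filter

/-- The error function `erf x = (2/√π) ∫₀ˣ e^{-s²} ds`. -/
noncomputable def erf (x : ℝ) : ℝ :=
  (2 / Real.sqrt Real.pi) * ∫ s in (0:ℝ)..x, Real.exp (-s ^ 2)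

/-- The spatial covariance function
`F t z = √(t/(2π)) e^{-z²/(8t)} + (z/4) erf(z/(2√(2t))) − |z|/4`. -/
noncomputable def F (t z : ℝ) : ℝ :=
  Real.sqrt (t / (2 * Real.pi)) * Real.exp (-z ^ 2 / (8 * t))
    + (z / 4) * erf (z / (2 * Real.sqrt (2 * t))) - |z| / 4

lemma erf_hasDerivAt (x : ℝ) :
    HasDerivAt erf ((2 / Real.sqrt Real.pi) * Real.exp (-x ^ 2)) x := by
  unfold erf
  apply HasDerivAt.const_mul
  have hc : Continuous (fun s : ℝ => Real.exp (-s ^ 2)) := by fun_prop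
  exact intervalIntegral.integral_hasDerivAt_right (hc.intervalIntegrable _ _)
    (hc.stronglyMeasurableAtFilter _ _) hc.continuousAt

lemma erf_tendsto : Tendsto erf atTop (nhds 1) := by
  have h1 : IntegrableOn (fun s : ℝ => Real.exp (-1 * s ^ 2)) (Set.Ioi 0) :=
    (integrable_exp_neg_mul_sq one_pos).integrableOn
  have h2 := intervalIntegral_tendsto_integral_Ioi 0 h1 tendsto_id
  rw [integral_gaussian_Ioi] at h2
  have h3 := h2.const_mul (2 / Real.sqrt Real.pi)
  have hp : Real.sqrt Real.pi ≠ 0 := by positivity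
  have e : 2 / Real.sqrt Real.pi * (Real.sqrt (Real.pi / 1) / 2) = 1 := by
    rw [div_one]; field_simp
  rw [e] at h3
  refine h3.congr (fun x => ?_)
  simp [erf]

lemma erf_neg' (x : ℝ) : erf (-x) = - erf x := by
  unfold erf
  have := intervalIntegral.integral_comp_neg (a := 0) (b := x)
    (fun s : ℝ => Real.exp (-s ^ 2))
  simp only [neg_sq, neg_zero] at this
  rw [this, intervalIntegral.integral_symm]
  ring

lemma F_neg (t z : ℝ) : F t (-z) = F t z := by
  unfold F
  rw [neg_div (2 * Real.sqrt (2 * t)) z, erf_neg', abs_neg, neg_sq]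
  ring

lemma F_hasDerivAt (z s : ℝ) (hs : 0 < s) :
    HasDerivAt (fun s => F s z)
      (1 / (2 * Real.sqrt (Real.pi * (2 * s))) * Real.exp (-z ^ 2 / (4 * (2 * s)))) s := by
  unfold F
  have hpi := Real.pi_pos
  have d1 : HasDerivAt (fun s : ℝ => Real.sqrt (s / (2 * Real.pi)))
      (1 / (2 * Real.pi) / (2 * Real.sqrt (s / (2 * Real.pi)))) s :=
    ((hasDerivAt_id s).div_const _).sqrt (by simp only [id]; positivity)
  have d2 : HasDerivAt (fun s : ℝ => Real.exp (-z ^ 2 / (8 * s)))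
      (Real.exp (-z ^ 2 / (8 * s)) * ((0 * (8 * s) - (-z ^ 2) * (8 * 1)) / (8 * s) ^ 2)) s :=
    ((hasDerivAt_const s (-z ^ 2)).div ((hasDerivAt_id s).const_mul 8)
      (by simp only [id]; positivity)).exp
  have d3 : HasDerivAt (fun s : ℝ => 2 * Real.sqrt (2 * s))
      (2 * ((2 * 1) / (2 * Real.sqrt (2 * s)))) s :=
    (((hasDerivAt_id s).const_mul 2).sqrt (by simp only [id]; positivity)).const_mul 2
  have d4 := (hasDerivAt_const s z).div d3 (by positivity)
  have d5 := (erf_hasDerivAt (z / (2 * Real.sqrt (2 * s)))).comp s d4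
  have d6 := ((d1.mul d2).add (d5.const_mul (z / 4))).sub_const (|z| / 4)
  refine d6.congr_deriv ?_
  have e1 : -(z / (2 * Real.sqrt (2 * s))) ^ 2 = -z ^ 2 / (8 * s) := by
    rw [div_pow, mul_pow, Real.sq_sqrt (by positivity)]; ring
  have e2 : -z ^ 2 / (4 * (2 * s)) = -z ^ 2 / (8 * s) := by ring
  rw [e1, e2]
  generalize Real.exp (-z ^ 2 / (8 * s)) = E
  rw [Real.sqrt_div hs.le, Real.sqrt_mul (by norm_num : (0:ℝ) ≤ 2) s,
    Real.sqrt_mul (by norm_num : (0:ℝ) ≤ 2) Real.pi, Real.sqrt_mul hpi.le,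
    Real.sqrt_mul (by norm_num : (0:ℝ) ≤ 2) s]
  obtain ⟨a, ha, rfl⟩ : ∃ a, 0 < a ∧ s = a ^ 2 := ⟨√s, by positivity, (Real.sq_sqrt hs.le).symm⟩
  have hp2 : Real.pi = √Real.pi ^ 2 := (Real.sq_sqrt hpi.le).symm
  have hpp : 0 < √Real.pi := by positivity
  have h2 : √(2:ℝ) ^ 2 = 2 := Real.sq_sqrt (by norm_num)
  have h2p : 0 < √(2:ℝ) := by positivity
  rw [Real.sqrt_sq ha.le]
  generalize √(2:ℝ) = c at *
  generalize √Real.pi = p at *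
  rw [hp2]
  have h4 : c ^ 4 = 4 := by rw [show c ^ 4 = (c ^ 2) ^ 2 by ring, h2]; norm_num
  have h3 : c ^ 3 = 2 * c := by rw [← h2]; ring
  field_simp
  ring_nf
  simp only [h2, h3, h4]
  ring

lemma F_tendsto_zero (z : ℝ) (hz : 0 ≤ z) :
    Tendsto (fun s => F s z) (nhdsWithin 0 (Set.Ioi 0)) (nhds 0) := by
  have hs0 : Tendsto (fun s : ℝ => Real.sqrt (s / (2 * Real.pi)))
      (nhdsWithin 0 (Set.Ioi 0)) (nhds 0) := by
    have : Continuous (fun s : ℝ => Real.sqrt (s / (2 * Real.pi))) := by fun_prop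
    have h := this.tendsto 0
    simp only [zero_div, Real.sqrt_zero] at h
    exact h.mono_left nhdsWithin_le_nhds
  have t1 : Tendsto (fun s : ℝ => Real.sqrt (s / (2 * Real.pi)) * Real.exp (-z ^ 2 / (8 * s)))
      (nhdsWithin 0 (Set.Ioi 0)) (nhds 0) := by
    refine squeeze_zero' (Eventually.of_forall fun s => by positivity) ?_ hs0
    filter_upwards [self_mem_nhdsWithin] with s hs
    have hs : 0 < s := hs
    refine mul_le_of_le_one_right (Real.sqrt_nonneg _) (Real.exp_le_one_iff.2 ?_)
    rw [neg_div]
    have : 0 ≤ z ^ 2 / (8 * s) := by positivity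
    linarith
  have t2 : Tendsto (fun s : ℝ => (z / 4) * erf (z / (2 * Real.sqrt (2 * s))))
      (nhdsWithin 0 (Set.Ioi 0)) (nhds (z / 4)) := by
    rcases hz.eq_or_lt with rfl | hz
    · simp
    · have h0 : Tendsto (fun s : ℝ => 2 * Real.sqrt (2 * s))
          (nhdsWithin 0 (Set.Ioi 0)) (nhdsWithin 0 (Set.Ioi 0)) := by
        refine tendsto_nhdsWithin_iff.2 ⟨?_, ?_⟩
        · have : Continuous (fun s : ℝ => 2 * Real.sqrt (2 * s)) := by fun_prop
          have h := this.tendsto 0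
          simp only [mul_zero, Real.sqrt_zero] at h
          exact h.mono_left nhdsWithin_le_nhds
        · filter_upwards [self_mem_nhdsWithin] with s hs
          have hs : 0 < s := hs
          show 0 < 2 * Real.sqrt (2 * s)
          positivity
      have h1 := (tendsto_inv_nhdsGT_zero.comp h0).const_mul_atTop hz
      have h2 := (erf_tendsto.comp h1).const_mul (z / 4)
      rw [mul_one] at h2
      exact h2
  have h := (t1.add t2).sub_const (|z| / 4)
  rw [abs_of_nonneg hz, zero_add, sub_self] at h
  unfold F
  rw [abs_of_nonneg hz]
  exact h

lemma kernel_integrable (t : ℝ) (ht : 0 < t) (z : ℝ) :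
    IntervalIntegrable (fun s : ℝ => 1 / (2 * Real.sqrt (Real.pi * (2 * s))) *
      Real.exp (-z ^ 2 / (4 * (2 * s)))) volume 0 t := by
  have h : IntervalIntegrable (fun s : ℝ => s ^ (-1/2 : ℝ)) volume 0 t :=
    intervalIntegral.intervalIntegrable_rpow' (by norm_num)
  refine h.mono_fun (by
    apply Measurable.aestronglyMeasurable
    fun_prop) ?_
  rw [Set.uIoc_of_le ht.le]
  refine (ae_restrict_iff' measurableSet_Ioc).2 (Eventually.of_forall fun s hs => ?_)
  have hs : 0 < s := hs.1
  have hpi := Real.pi_gt_three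
  beta_reduce
  rw [Real.norm_of_nonneg (by positivity), Real.norm_of_nonneg (by positivity),
    show (-1/2 : ℝ) = -(1/2) by norm_num, Real.rpow_neg hs.le, ← Real.sqrt_eq_rpow, ← one_div]
  have hle : Real.sqrt s ≤ 2 * Real.sqrt (Real.pi * (2 * s)) := by
    have : Real.sqrt s ≤ Real.sqrt (Real.pi * (2 * s)) := Real.sqrt_le_sqrt (by nlinarith)
    have := Real.sqrt_nonneg (Real.pi * (2 * s))
    linarith
  refine (mul_le_of_le_one_right (by positivity) (Real.exp_le_one_iff.2 ?_)).trans
    (one_div_le_one_div_of_le (by positivity) hle)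
  rw [neg_div]
  have : 0 ≤ z ^ 2 / (4 * (2 * s)) := by positivity
  linarith

lemma closed_form_nonneg (t : ℝ) (ht : 0 < t) (z : ℝ) (hz : 0 ≤ z) :
    (∫ s in (0:ℝ)..t, 1 / (2 * Real.sqrt (Real.pi * (2 * s))) *
      Real.exp (-z ^ 2 / (4 * (2 * s)))) = F t z := by
  have h := intervalIntegral.integral_eq_sub_of_hasDerivAt_of_tendsto ht
    (fun s hs => F_hasDerivAt z s hs.1) (kernel_integrable t ht z) (F_tendsto_zero z hz)
    ((F_hasDerivAt z t ht).continuousAt.tendsto.mono_left nhdsWithin_le_nhds)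
  rw [h, sub_zero]

/-- Closed form of the equal-time spatial covariance integral:
`∫₀ᵗ (1/(2√(π(2t−2r)))) e^{−z²/(4(2t−2r))} dr = F t z`. -/
theorem spatial_covariance_closed_form (t : ℝ) (ht : 0 < t) (z : ℝ) :
    (∫ r in (0:ℝ)..t,
      (1 / (2 * Real.sqrt (Real.pi * (2 * t - 2 * r))))
        * Real.exp (-z ^ 2 / (4 * (2 * t - 2 * r)))) = F t z := by
  have h := intervalIntegral.integral_comp_sub_left (a := 0) (b := t)
    (fun s : ℝ => 1 / (2 * Real.sqrt (Real.pi * (2 * s))) *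
      Real.exp (-z ^ 2 / (4 * (2 * s)))) t
  simp only [mul_sub, sub_self, sub_zero] at h ⊢
  rw [h]
  rcases le_total 0 z with hz | hz
  · exact closed_form_nonneg t ht z hz
  · have h2 := closed_form_nonneg t ht (-z) (by linarith)
    rwa [F_neg, neg_sq] at h2
end

section
/- Fix 0 < T₁ < T₂. There exists a constant C = C(T₁, T₂) < ∞ such that for all s, t ∈ [T₁, T₂] and all δ with 0 < δ ≤ t − s, one has |g(s+δ, t+δ) − g(s+δ, t) − g(s, t+δ) + g(s, t)| ≤ C (δ² + (t − s)^{−3/2} δ²). Equivalently, since g(s+δ,t+δ) − g(s+δ,t) − g(s,t+δ) + g(s,t) = −(1/(2√π))[2√(t+s+δ) − √(t+s+2δ) − √(t+s) + 2√(t−s) − √(t−s+δ) − √(t−s−δ)], this second difference of g is bounded by C δ²(1 + (t−s)^{−3/2}). -/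
open MeasureTheory ProbabilityTheory Filter

/-- The temporal covariance function `g s t = (1/(2√π))(√(t+s) − √|t−s|)`. -/
noncomputable def gcov (s t : ℝ) : ℝ :=
  (1 / (2 * Real.sqrt Real.pi)) * (Real.sqrt (t + s) - Real.sqrt |t - s|)

lemma le_of_sq_le_sq_aux (u v : ℝ) (h : u ^ 2 ≤ v ^ 2) (hv : 0 ≤ v) : u ≤ v :=
  abs_le_of_sq_le_sq' h hv |>.2

lemma sqrt_second_diff (x d : ℝ) (hx : 0 < x) (hd : 0 ≤ d) (hdx : d ≤ x) :
    0 ≤ 2 * Real.sqrt x - Real.sqrt (x + d) - Real.sqrt (x - d) ∧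
    2 * Real.sqrt x - Real.sqrt (x + d) - Real.sqrt (x - d) ≤ d ^ 2 * (x * Real.sqrt x)⁻¹ := by
  have hm : 0 < Real.sqrt x := Real.sqrt_pos.mpr hx
  have ha : 0 ≤ Real.sqrt (x + d) := Real.sqrt_nonneg _
  have hb : 0 ≤ Real.sqrt (x - d) := Real.sqrt_nonneg _
  have hm2 := Real.sq_sqrt hx.le
  have ha2 := Real.sq_sqrt (show 0 ≤ x + d by linarith)
  have hb2 := Real.sq_sqrt (show 0 ≤ x - d by linarith)
  set m := Real.sqrt x
  set a := Real.sqrt (x + d)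
  set b := Real.sqrt (x - d)
  have hab : 0 ≤ a * b := mul_nonneg ha hb
  have hab2 : (a * b) ^ 2 = x ^ 2 - d ^ 2 := by rw [mul_pow, ha2, hb2]; ring
  have habx : a * b ≤ x := by
    apply le_of_sq_le_sq_aux _ _ _ hx.le
    rw [hab2]; nlinarith [sq_nonneg d]
  constructor
  · have : a + b ≤ 2 * m := by
      apply le_of_sq_le_sq_aux _ _ _ (by linarith)
      nlinarith
    linarith
  · set q := d ^ 2 * (x * m)⁻¹ with hq
    have hq0 : 0 ≤ q := by positivity
    have hqe : q * (x * m) = d ^ 2 := by rw [hq]; field_simp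
    have hqm : q ≤ m := by
      rw [hq, ← div_eq_mul_inv, div_le_iff₀ (by positivity)]
      nlinarith
    have h1 : x - q * m ≤ a * b := by
      have : x * (x - q * m) ≤ x * (a * b) := by nlinarith
      exact le_of_mul_le_mul_left this hx
    have : 2 * m - q ≤ a + b := by
      apply le_of_sq_le_sq_aux _ _ _ (by linarith)
      nlinarith [mul_nonneg hq0 (sub_nonneg.mpr hqm), mul_nonneg hq0 hm.le]
    linarith

/-- Covariance of disjoint temporal increments: exact identity and the bound
`O(δ²) + O((t−s)^{−3/2} δ²)`, uniformly over `s, t ∈ [T₁, T₂]`, `0 < δ ≤ t − s`. -/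
theorem temporal_increment_covariance (T₁ T₂ : ℝ) (hT₁ : 0 < T₁) (hT : T₁ < T₂) :
    ∃ C : ℝ, ∀ s t δ : ℝ, T₁ ≤ s → s ≤ T₂ → T₁ ≤ t → t ≤ T₂ → 0 < δ → δ ≤ t - s →
      (gcov (s + δ) (t + δ) - gcov (s + δ) t - gcov s (t + δ) + gcov s t =
        -(1 / (2 * Real.sqrt Real.pi)) *
          (2 * Real.sqrt (t + s + δ) - Real.sqrt (t + s + 2 * δ) - Real.sqrt (t + s)
            + 2 * Real.sqrt (t - s) - Real.sqrt (t - s + δ) - Real.sqrt (t - s - δ))) ∧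
      |gcov (s + δ) (t + δ) - gcov (s + δ) t - gcov s (t + δ) + gcov s t|
        ≤ C * (δ ^ 2 + (t - s) ^ (-(3:ℝ) / 2) * δ ^ 2) := by
  set K : ℝ := 1 / (2 * Real.sqrt Real.pi) with hK
  have hK0 : 0 ≤ K := by positivity
  refine ⟨K * ((T₁ * Real.sqrt T₁)⁻¹ + 1), ?_⟩
  intro s t δ hs hs' ht ht' hδ hδt
  have hts : 0 < t - s := by linarith
  have key : gcov (s + δ) (t + δ) - gcov (s + δ) t - gcov s (t + δ) + gcov s t =
        -K *
          (2 * Real.sqrt (t + s + δ) - Real.sqrt (t + s + 2 * δ) - Real.sqrt (t + s)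
            + 2 * Real.sqrt (t - s) - Real.sqrt (t - s + δ) - Real.sqrt (t - s - δ)) := by
    unfold gcov
    rw [← hK, abs_of_nonneg (show 0 ≤ t + δ - (s + δ) by linarith),
      abs_of_nonneg (show 0 ≤ t - (s + δ) by linarith),
      abs_of_nonneg (show 0 ≤ t + δ - s by linarith), abs_of_nonneg hts.le,
      show t + δ + (s + δ) = t + s + 2 * δ by ring, show t + δ - (s + δ) = t - s by ring,
      show t + (s + δ) = t + s + δ by ring, show t - (s + δ) = t - s - δ by ring,
      show t + δ + s = t + s + δ by ring, show t + δ - s = t - s + δ by ring]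
    ring
  refine ⟨key, ?_⟩
  rw [key]
  obtain ⟨h1, h2⟩ := sqrt_second_diff (t + s + δ) δ (by linarith) hδ.le (by linarith)
  obtain ⟨h3, h4⟩ := sqrt_second_diff (t - s) δ hts hδ.le hδt
  rw [show t + s + δ + δ = t + s + 2 * δ by ring, show t + s + δ - δ = t + s by ring] at h1 h2
  have hp : (t - s) ^ (-(3:ℝ) / 2) = ((t - s) * Real.sqrt (t - s))⁻¹ := by
    rw [show (-(3:ℝ) / 2) = -(1 + 1 / 2) by norm_num, Real.rpow_neg hts.le,
      Real.rpow_add hts, Real.rpow_one, Real.sqrt_eq_rpow]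
  have hP : 0 ≤ (t - s) ^ (-(3:ℝ) / 2) := Real.rpow_nonneg hts.le _
  rw [← hp] at h4
  have hA0 : 0 < T₁ * Real.sqrt T₁ := mul_pos hT₁ (Real.sqrt_pos.mpr hT₁)
  have h5 : ((t + s + δ) * Real.sqrt (t + s + δ))⁻¹ ≤ (T₁ * Real.sqrt T₁)⁻¹ := by
    apply inv_anti₀ hA0
    have h : T₁ ≤ t + s + δ := by linarith
    exact mul_le_mul h (Real.sqrt_le_sqrt h) (Real.sqrt_nonneg _) (by linarith)
  have h6 := mul_le_mul_of_nonneg_left h5 (sq_nonneg δ)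
  have hA : 0 ≤ (T₁ * Real.sqrt T₁)⁻¹ := (inv_pos.mpr hA0).le
  generalize (T₁ * Real.sqrt T₁)⁻¹ = A at *
  generalize (t - s) ^ (-(3:ℝ) / 2) = P at *
  rw [abs_mul, abs_neg, abs_of_nonneg hK0, mul_assoc]
  apply mul_le_mul_of_nonneg_left _ hK0
  rw [abs_of_nonneg (by linarith)]
  have h7 : 0 ≤ A * (P * δ ^ 2) := by positivity
  nlinarith [sq_nonneg δ]
end

section
/- For every λ > 0 and T > 0 there exists a constant C = C(λ, T) < ∞ such that for all δ ∈ [0, 1], all 0 ≤ s < t ≤ T, and all x ∈ ℝ, ∫₀^s ∫_ℝ (G_{t−r}(x + δ − u) − G_{t−r}(x − u))² · e^{λ|u|} du dr ≤ C δ² (t − s)^{−1/2} e^{λ|x|}. -/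
open MeasureTheory Filter

/-- The one-dimensional heat kernel `G t x = (1/(2√(πt))) e^{-x²/(4t)}` for `t > 0`,
with the convention `G t x = 0` for `t ≤ 0`. -/
noncomputable def G (t x : ℝ) : ℝ :=
  if 0 < t then (1 / (2 * Real.sqrt (Real.pi * t))) * Real.exp (-x ^ 2 / (4 * t)) else 0

lemma aux_gauss_int (τ c : ℝ) (hτ : 0 < τ) (x : ℝ) :
    Integrable (fun u : ℝ => Real.exp (-(x - u + c) ^ 2 / (2 * τ))) ∧
    ∫ u : ℝ, Real.exp (-(x - u + c) ^ 2 / (2 * τ)) = Real.sqrt (2 * Real.pi * τ) := by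
  have hb : 0 < 1 / (2 * τ) := by positivity
  have e : (fun u : ℝ => Real.exp (-(x - u + c) ^ 2 / (2 * τ))) =
      fun u : ℝ => (fun w : ℝ => Real.exp (-(1 / (2 * τ)) * w ^ 2)) ((x + c) - u) := by
    funext u
    simp only
    congr 1
    ring
  rw [e]
  refine ⟨(integrable_exp_neg_mul_sq hb).comp_sub_left (x + c), ?_⟩
  rw [integral_sub_left_eq_self (fun w : ℝ => Real.exp (-(1 / (2 * τ)) * w ^ 2)) volume (x + c),
    integral_gaussian]
  congr 1
  field_simp

/-- Pointwise identity after completing the square. -/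
lemma aux_point (τ δ μ v : ℝ) (hτ : 0 < τ) :
    (G τ (v + δ) - G τ v) ^ 2 * Real.exp (μ * v) =
      (1 / (4 * Real.pi * τ)) * Real.exp (μ ^ 2 * τ / 2) *
        (Real.exp (-μ * δ) * Real.exp (-(v + (δ - μ * τ)) ^ 2 / (2 * τ))
          + Real.exp (-(v + (-μ * τ)) ^ 2 / (2 * τ))
          - 2 * (Real.exp (-μ * δ / 2) * Real.exp (-δ ^ 2 / (8 * τ))) *
            Real.exp (-(v + (δ / 2 - μ * τ)) ^ 2 / (2 * τ))) := by
  have hs : (1 / (2 * Real.sqrt (Real.pi * τ))) ^ 2 = 1 / (4 * Real.pi * τ) := by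
    rw [div_pow, mul_pow, Real.sq_sqrt (by positivity)]
    ring
  have h1 : Real.exp (-(v + δ) ^ 2 / (4 * τ)) ^ 2 * Real.exp (μ * v) =
      Real.exp (μ ^ 2 * τ / 2) *
      (Real.exp (-μ * δ) * Real.exp (-(v + (δ - μ * τ)) ^ 2 / (2 * τ))) := by
    rw [sq, ← Real.exp_add, ← Real.exp_add, ← Real.exp_add, ← Real.exp_add]
    congr 1
    field_simp
    ring
  have h2 : Real.exp (-v ^ 2 / (4 * τ)) ^ 2 * Real.exp (μ * v) =
      Real.exp (μ ^ 2 * τ / 2) * Real.exp (-(v + (-μ * τ)) ^ 2 / (2 * τ)) := by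
    rw [sq, ← Real.exp_add, ← Real.exp_add, ← Real.exp_add]
    congr 1
    field_simp
    ring
  have h3 : Real.exp (-(v + δ) ^ 2 / (4 * τ)) * Real.exp (-v ^ 2 / (4 * τ)) * Real.exp (μ * v) =
      Real.exp (μ ^ 2 * τ / 2) * (Real.exp (-μ * δ / 2) * Real.exp (-δ ^ 2 / (8 * τ)) *
        Real.exp (-(v + (δ / 2 - μ * τ)) ^ 2 / (2 * τ))) := by
    simp only [← Real.exp_add]
    congr 1
    field_simp
    ring
  simp only [G, if_pos hτ]
  rw [← mul_sub, mul_pow, hs]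
  linear_combination (1 / (4 * Real.pi * τ)) * (h1 + h2 - 2 * h3)

lemma aux_int (τ δ μ x : ℝ) (hτ : 0 < τ) :
    Integrable (fun u : ℝ => (G τ (x - u + δ) - G τ (x - u)) ^ 2 * Real.exp (μ * (x - u))) ∧
    ∫ u : ℝ, (G τ (x - u + δ) - G τ (x - u)) ^ 2 * Real.exp (μ * (x - u)) =
      (1 / (4 * Real.pi * τ)) * Real.exp (μ ^ 2 * τ / 2) * Real.sqrt (2 * Real.pi * τ) *
        (Real.exp (-μ * δ) + 1 - 2 * (Real.exp (-μ * δ / 2) * Real.exp (-δ ^ 2 / (8 * τ)))) := by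
  simp only [aux_point τ δ μ _ hτ]
  obtain ⟨i1, e1⟩ := aux_gauss_int τ (δ - μ * τ) hτ x
  obtain ⟨i2, e2⟩ := aux_gauss_int τ (-μ * τ) hτ x
  obtain ⟨i3, e3⟩ := aux_gauss_int τ (δ / 2 - μ * τ) hτ x
  have j1 := i1.const_mul (Real.exp (-μ * δ))
  have j3 := i3.const_mul (2 * (Real.exp (-μ * δ / 2) * Real.exp (-δ ^ 2 / (8 * τ))))
  refine ⟨((j1.add i2).sub j3).const_mul _, ?_⟩
  have j12 : Integrable (fun u : ℝ =>
      Real.exp (-μ * δ) * Real.exp (-(x - u + (δ - μ * τ)) ^ 2 / (2 * τ)) +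
        Real.exp (-(x - u + (-μ * τ)) ^ 2 / (2 * τ))) := j1.add i2
  rw [integral_const_mul, integral_sub j12 j3, integral_add j1 i2, integral_const_mul,
    integral_const_mul, e1, e2, e3]
  ring

lemma aux_scalar (lam T τ δ μ : ℝ) (hlam : 0 < lam) (hμ : |μ| = lam) (hτ : 0 < τ) (hτT : τ ≤ T)
    (hδ : 0 ≤ δ) (hδ1 : δ ≤ 1) :
    (1 / (4 * Real.pi * τ)) * Real.exp (μ ^ 2 * τ / 2) * Real.sqrt (2 * Real.pi * τ) *
        (Real.exp (-μ * δ) + 1 - 2 * (Real.exp (-μ * δ / 2) * Real.exp (-δ ^ 2 / (8 * τ)))) ≤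
      Real.exp (lam ^ 2 * T / 2) * Real.exp lam * (lam ^ 2 * T + 1) * δ ^ 2 *
        τ ^ (-(3:ℝ) / 2) := by
  have hμ2 : μ ^ 2 = lam ^ 2 := by rw [← hμ, sq_abs]
  have hE : Real.exp (μ ^ 2 * τ / 2) ≤ Real.exp (lam ^ 2 * T / 2) := by
    rw [hμ2]; gcongr
  have hK : 1 / (4 * Real.pi * τ) * Real.sqrt (2 * Real.pi * τ) ≤ τ ^ (-(1:ℝ) / 2) := by
    have h1 : τ ^ (-(1:ℝ) / 2) = 1 / Real.sqrt τ := by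
      rw [Real.sqrt_eq_rpow, neg_div, Real.rpow_neg hτ.le, ← one_div]
    rw [h1, Real.sqrt_mul (by positivity), le_div_iff₀ (by positivity)]
    have h2 : Real.sqrt τ * Real.sqrt τ = τ := Real.mul_self_sqrt hτ.le
    have h3 : Real.sqrt (2 * Real.pi) ≤ 4 * Real.pi := by
      rw [Real.sqrt_le_left (by positivity)]
      nlinarith [Real.pi_gt_three]
    calc 1 / (4 * Real.pi * τ) * (Real.sqrt (2 * Real.pi) * Real.sqrt τ) * Real.sqrt τ
        = 1 / (4 * Real.pi * τ) * (Real.sqrt (2 * Real.pi) * (Real.sqrt τ * Real.sqrt τ)) := by ring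
      _ = Real.sqrt (2 * Real.pi) / (4 * Real.pi) := by rw [h2]; field_simp
      _ ≤ 1 := by rw [div_le_one (by positivity)]; exact h3
  have habs : |(-μ * δ / 2)| ≤ lam / 2 := by
    rw [abs_div, abs_mul, abs_neg, hμ, abs_of_nonneg hδ, abs_two]
    nlinarith
  set y := -μ * δ / 2 with hy
  have hy2 : y ^ 2 = lam ^ 2 * δ ^ 2 / 4 := by rw [hy, ← hμ2]; ring
  have hexp2 : Real.exp (-μ * δ) = Real.exp y ^ 2 := by
    rw [sq, ← Real.exp_add]; congr 1; rw [hy]; ring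
  have hyle := abs_le.1 habs
  have hsq : (Real.exp y - 1) ^ 2 ≤ Real.exp lam * y ^ 2 := by
    have hl : Real.exp lam = Real.exp (lam / 2) ^ 2 := by
      rw [sq, ← Real.exp_add]; congr 1; ring
    have hg : 1 ≤ Real.exp (lam / 2) := Real.one_le_exp (by linarith)
    have hle : Real.exp y ≤ Real.exp (lam / 2) := Real.exp_le_exp.2 hyle.2
    have k1 := Real.add_one_le_exp y
    have k2 : Real.exp y - 1 ≤ Real.exp y * y := by
      have h := mul_le_mul_of_nonneg_left (Real.add_one_le_exp (-y)) (Real.exp_pos y).le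
      rw [← Real.exp_add, add_neg_cancel, Real.exp_zero] at h
      linarith
    rw [hl, ← mul_pow, sq_le_sq, abs_mul, abs_of_pos (Real.exp_pos (lam / 2))]
    have k3 : Real.exp y * y ≤ Real.exp (lam / 2) * |y| :=
      (mul_le_mul_of_nonneg_left (le_abs_self y) (Real.exp_pos y).le).trans
        (mul_le_mul_of_nonneg_right hle (abs_nonneg y))
    have k4 : |y| ≤ Real.exp (lam / 2) * |y| := le_mul_of_one_le_left (abs_nonneg y) hg
    have k5 := neg_abs_le y
    exact abs_le.2 ⟨by linarith, by linarith⟩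
  have hlast : 1 - Real.exp (-δ ^ 2 / (8 * τ)) ≤ δ ^ 2 / (8 * τ) := by
    have := Real.add_one_le_exp (-δ ^ 2 / (8 * τ))
    have e : -δ ^ 2 / (8 * τ) = - (δ ^ 2 / (8 * τ)) := by ring
    rw [e] at this ⊢
    linarith
  have hylam : Real.exp y ≤ Real.exp lam := Real.exp_le_exp.2 (by linarith)
  have hB : Real.exp (-μ * δ) + 1 - 2 * (Real.exp y * Real.exp (-δ ^ 2 / (8 * τ))) ≤
      Real.exp lam * (lam ^ 2 * T + 1) * δ ^ 2 * τ⁻¹ := by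
    have hT1 : 1 ≤ T * τ⁻¹ := by
      rw [← div_eq_mul_inv, le_div_iff₀ hτ]; linarith
    calc _ = (Real.exp y - 1) ^ 2 + 2 * (Real.exp y * (1 - Real.exp (-δ ^ 2 / (8 * τ)))) := by
          rw [hexp2]; ring
      _ ≤ Real.exp lam * y ^ 2 + 2 * (Real.exp lam * (δ ^ 2 / (8 * τ))) := by
          have : Real.exp y * (1 - Real.exp (-δ ^ 2 / (8 * τ))) ≤
              Real.exp lam * (δ ^ 2 / (8 * τ)) :=
            (mul_le_mul_of_nonneg_left hlast (Real.exp_pos _).le).trans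
              (mul_le_mul_of_nonneg_right hylam (by positivity))
          linarith
      _ = Real.exp lam * δ ^ 2 * (lam ^ 2 * 1 / 4 + τ⁻¹ / 4) := by
          rw [hy2]; field_simp; ring
      _ ≤ Real.exp lam * δ ^ 2 * (lam ^ 2 * (T * τ⁻¹) + τ⁻¹) := by
          have h1 : 0 < τ⁻¹ := by positivity
          have h2 : lam ^ 2 * 1 ≤ lam ^ 2 * (T * τ⁻¹) := by gcongr
          have h3 : 0 < lam ^ 2 := by positivity
          gcongr ?_ * ?_
          linarith
      _ = _ := by ring
  have hpow : τ ^ (-(3:ℝ) / 2) = τ ^ (-(1:ℝ) / 2) * τ⁻¹ := by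
    rw [← Real.rpow_neg_one, ← Real.rpow_add hτ]; norm_num
  have hTpos : 0 < T := hτ.trans_le hτT
  calc _ = (Real.exp (μ ^ 2 * τ / 2) * (1 / (4 * Real.pi * τ) * Real.sqrt (2 * Real.pi * τ))) *
        (Real.exp (-μ * δ) + 1 - 2 * (Real.exp y * Real.exp (-δ ^ 2 / (8 * τ)))) := by ring
    _ ≤ (Real.exp (μ ^ 2 * τ / 2) * (1 / (4 * Real.pi * τ) * Real.sqrt (2 * Real.pi * τ))) *
        (Real.exp lam * (lam ^ 2 * T + 1) * δ ^ 2 * τ⁻¹) := by gcongr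
    _ ≤ (Real.exp (lam ^ 2 * T / 2) * τ ^ (-(1:ℝ) / 2)) *
        (Real.exp lam * (lam ^ 2 * T + 1) * δ ^ 2 * τ⁻¹) := by gcongr
    _ = _ := by rw [hpow]; ring

lemma aux_inner (lam T τ δ x : ℝ) (hlam : 0 < lam) (hτ : 0 < τ) (hτT : τ ≤ T)
    (hδ : 0 ≤ δ) (hδ1 : δ ≤ 1) :
    (∫ u : ℝ, (G τ (x + δ - u) - G τ (x - u)) ^ 2 * Real.exp (lam * |u|)) ≤
      (2 * (Real.exp (lam ^ 2 * T / 2) * Real.exp lam * (lam ^ 2 * T + 1)) * δ ^ 2 *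
        Real.exp (lam * |x|)) * τ ^ (-(3:ℝ) / 2) := by
  obtain ⟨i1, e1⟩ := aux_int τ δ lam x hτ
  obtain ⟨i2, e2⟩ := aux_int τ δ (-lam) x hτ
  have b1 := aux_scalar lam T τ δ lam hlam (abs_of_pos hlam) hτ hτT hδ hδ1
  have b2 := aux_scalar lam T τ δ (-lam) hlam (by rw [abs_neg, abs_of_pos hlam]) hτ hτT hδ hδ1
  rw [← e1] at b1
  rw [← e2] at b2
  have hm := integral_mono_of_nonneg (μ := volume)
    (f := fun u : ℝ => (G τ (x + δ - u) - G τ (x - u)) ^ 2 * Real.exp (lam * |u|))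
    (Eventually.of_forall fun u => by positivity)
    ((i1.add i2).const_mul (Real.exp (lam * |x|)))
    (Eventually.of_forall fun u => by
      have hx : x + δ - u = x - u + δ := by ring
      simp only [Pi.add_apply]
      rw [hx, ← mul_add, mul_left_comm]
      refine mul_le_mul_of_nonneg_left ?_ (sq_nonneg _)
      have h1 : Real.exp (lam * |u|) ≤ Real.exp (lam * |x|) * Real.exp (lam * |x - u|) := by
        rw [← Real.exp_add, ← mul_add]
        have : |u| ≤ |x| + |x - u| := by
          have := abs_sub x (x - u)
          simpa using this
        gcongr
      refine h1.trans (mul_le_mul_of_nonneg_left ?_ (Real.exp_pos _).le)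
      have p1 := Real.exp_pos (lam * (x - u))
      have p2 := Real.exp_pos (-lam * (x - u))
      rcases abs_cases (x - u) with ⟨h, _⟩ | ⟨h, _⟩
      · rw [h]; linarith
      · rw [h, mul_neg, ← neg_mul]; linarith)
  refine hm.trans ?_
  rw [integral_const_mul]
  simp only [Pi.add_apply]
  rw [integral_add i1 i2]
  calc _ ≤ Real.exp (lam * |x|) * (_ + _) :=
        mul_le_mul_of_nonneg_left (add_le_add b1 b2) (Real.exp_pos _).le
    _ = _ := by ring

/-- Heat-kernel estimate for spatial increments:
`∫₀ˢ ∫ (G_{t−r}(x+δ−u) − G_{t−r}(x−u))² e^{λ|u|} du dr ≤ C δ² (t−s)^{−1/2} e^{λ|x|}`. -/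
theorem heat_kernel_spatial_increment_estimate (lam T : ℝ) (hlam : 0 < lam) (hT : 0 < T) :
    ∃ C : ℝ, ∀ δ s t x : ℝ, 0 ≤ δ → δ ≤ 1 → 0 ≤ s → s < t → t ≤ T →
      (∫ r in (0:ℝ)..s, ∫ u : ℝ,
          (G (t - r) (x + δ - u) - G (t - r) (x - u)) ^ 2 * Real.exp (lam * |u|))
        ≤ C * δ ^ 2 * (t - s) ^ (-(1:ℝ) / 2) * Real.exp (lam * |x|) := by
  refine ⟨2 * (2 * (Real.exp (lam ^ 2 * T / 2) * Real.exp lam * (lam ^ 2 * T + 1))), ?_⟩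
  intro δ s t x hδ hδ1 hs hst htT
  set A := 2 * (Real.exp (lam ^ 2 * T / 2) * Real.exp lam * (lam ^ 2 * T + 1)) with hA
  have hApos : 0 < A := by positivity
  have hts : 0 < t - s := by linarith
  have hcont : ContinuousOn (fun r : ℝ => (A * δ ^ 2 * Real.exp (lam * |x|)) *
      (t - r) ^ (-(3:ℝ) / 2)) (Set.uIcc 0 s) := by
    refine ContinuousOn.mul continuousOn_const ?_
    refine ContinuousOn.rpow_const (by fun_prop) ?_
    intro r hr
    rw [Set.uIcc_of_le hs] at hr
    left
    have := hr.2
    linarith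
  have hint := hcont.intervalIntegrable (μ := volume)
  have hmono : (∫ r in (0:ℝ)..s, ∫ u : ℝ,
          (G (t - r) (x + δ - u) - G (t - r) (x - u)) ^ 2 * Real.exp (lam * |u|)) ≤
      ∫ r in (0:ℝ)..s, (A * δ ^ 2 * Real.exp (lam * |x|)) * (t - r) ^ (-(3:ℝ) / 2) := by
    rw [intervalIntegral.integral_of_le hs, intervalIntegral.integral_of_le hs]
    rw [intervalIntegrable_iff_integrableOn_Ioc_of_le hs] at hint
    refine integral_mono_of_nonneg
      (Eventually.of_forall fun r => integral_nonneg fun u => by positivity) hint ?_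
    refine (ae_restrict_iff' measurableSet_Ioc).2 (Eventually.of_forall fun r hr => ?_)
    exact aux_inner lam T (t - r) δ x hlam (by linarith [hr.2]) (by linarith [hr.1]) hδ hδ1
  refine hmono.trans ?_
  rw [intervalIntegral.integral_const_mul,
    intervalIntegral.integral_comp_sub_left (fun w : ℝ => w ^ (-(3:ℝ) / 2)) t,
    integral_rpow (Or.inr ⟨by norm_num, by
      rw [Set.uIcc_of_le (by linarith)]
      intro h
      linarith [h.1]⟩)]
  have he : -(3:ℝ) / 2 + 1 = -(1:ℝ) / 2 := by norm_num
  rw [he, sub_zero]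
  have hp : 0 ≤ t ^ (-(1:ℝ) / 2) := Real.rpow_nonneg (by linarith) _
  have hfin : (t ^ (-(1:ℝ) / 2) - (t - s) ^ (-(1:ℝ) / 2)) / (-(1:ℝ) / 2) ≤
      2 * (t - s) ^ (-(1:ℝ) / 2) := by
    have : (t ^ (-(1:ℝ) / 2) - (t - s) ^ (-(1:ℝ) / 2)) / (-(1:ℝ) / 2) =
      2 * (t - s) ^ (-(1:ℝ) / 2) - 2 * t ^ (-(1:ℝ) / 2) := by ring
    rw [this]; linarith
  calc _ ≤ A * δ ^ 2 * Real.exp (lam * |x|) * (2 * (t - s) ^ (-(1:ℝ) / 2)) :=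
        mul_le_mul_of_nonneg_left hfin (by positivity)
    _ = _ := by ring
end

section
/- For every λ > 0 and T > 0 there exists a constant C = C(λ, T) < ∞ such that for all δ ∈ [0, 1], all 0 ≤ s < t ≤ T, and all x ∈ ℝ, ∫₀^s ∫_ℝ (G_{t+δ−r}(x − u) − G_{t−r}(x − u))² · e^{λ|u|} du dr ≤ C δ² (t − s)^{−3/2} e^{λ|x|}. -/
open MeasureTheory Filter

lemma G_diff_sq (τ δ z : ℝ) (hτ : 0 < τ) (hδ : 0 ≤ δ) :
    (G (τ + δ) z - G τ z) ^ 2 ≤ 8 * (δ / τ) ^ 2 *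
      (1 / (τ + δ) * Real.exp (-z ^ 2 / (4 * (τ + δ))) + 1 / τ * Real.exp (-z ^ 2 / (4 * τ))) := by
  have hσ : 0 < τ + δ := by linarith
  have hpi := Real.pi_gt_three
  have hsq : ∀ y : ℝ, 0 < y → (1 / (2 * Real.sqrt (Real.pi * y))) ^ 2 = 1 / (4 * Real.pi * y) := by
    intro y hy
    rw [div_pow, mul_pow, Real.sq_sqrt (by positivity)]
    ring
  have hle : ∀ y : ℝ, 0 < y → 1 / (4 * Real.pi * y) ≤ 1 / y := by
    intro y hy
    apply one_div_le_one_div_of_le hy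
    nlinarith
  unfold G
  rw [if_pos hσ, if_pos hτ]
  have hA2 := hsq τ hτ
  have hB2 := hsq _ hσ
  have hA0 : 0 < 1 / (2 * Real.sqrt (Real.pi * τ)) := by positivity
  have hB0 : 0 < 1 / (2 * Real.sqrt (Real.pi * (τ + δ))) := by positivity
  have hA1 := hle τ hτ
  have hB1 := hle _ hσ
  set A := 1 / (2 * Real.sqrt (Real.pi * τ))
  set B := 1 / (2 * Real.sqrt (Real.pi * (τ + δ)))
  have hd : A ^ 2 - B ^ 2 = A ^ 2 * (δ / (τ + δ)) := by
    rw [hA2, hB2]; field_simp; ring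
  have hdd : δ / (τ + δ) ≤ δ / τ := div_le_div_of_nonneg_left hδ hτ (by linarith)
  have hdd0 : 0 ≤ δ / (τ + δ) := by positivity
  have hBA : B ≤ A := by
    apply le_of_sq_le_sq _ hA0.le
    nlinarith [sq_nonneg A, mul_nonneg (sq_nonneg A) hdd0]
  have hAB : A - B ≤ A * (δ / τ) := by
    have h1 : (A - B) * A ≤ A * (δ / (τ + δ)) * A := by nlinarith
    have h2 := le_of_mul_le_mul_right h1 hA0
    nlinarith
  obtain ⟨a, ha⟩ : ∃ a, a = z ^ 2 / (4 * τ) := ⟨_, rfl⟩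
  obtain ⟨b, hb⟩ : ∃ b, b = z ^ 2 / (4 * (τ + δ)) := ⟨_, rfl⟩
  rw [show -z ^ 2 / (4 * τ) = -a by rw [ha]; ring,
    show -z ^ 2 / (4 * (τ + δ)) = -b by rw [hb]; ring]
  have hb0 : 0 ≤ b := by rw [hb]; positivity
  have ha0 : 0 ≤ a := by rw [ha]; positivity
  have hab : a - b = b * (δ / τ) := by rw [ha, hb]; field_simp; ring
  set q := δ / τ
  have hq : 0 ≤ q := by positivity
  have hba : b ≤ a := by nlinarith [mul_nonneg hb0 hq]
  -- exponential estimates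
  have e1 : Real.exp (-a) ≤ Real.exp (-b) := Real.exp_le_exp.2 (by linarith)
  have e2 : Real.exp (-b) - Real.exp (-a) ≤ q * (b * Real.exp (-b)) := by
    have h := Real.add_one_le_exp (b - a)
    have h' : Real.exp (-a) = Real.exp (-b) * Real.exp (b - a) := by
      rw [← Real.exp_add]; ring_nf
    rw [h']
    nlinarith [Real.exp_pos (-b)]
  have e3 : b * Real.exp (-b) ≤ 2 * Real.exp (-(b / 2)) := by
    have h := Real.add_one_le_exp (b / 2)
    have h' : Real.exp (-b) = Real.exp (-(b/2)) * Real.exp (-(b/2)) := by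
      rw [← Real.exp_add]; ring_nf
    have h'' : Real.exp (b/2) * Real.exp (-(b/2)) = 1 := by
      rw [← Real.exp_add]; simp
    have h3 : b * Real.exp (-(b/2)) ≤ 2 := by nlinarith [Real.exp_pos (-(b/2))]
    rw [h']
    nlinarith [Real.exp_pos (-(b/2))]
  have e4 : Real.exp (-(b / 2)) ^ 2 = Real.exp (-b) := by
    rw [← Real.exp_nat_mul]; ring_nf
  have e5 : Real.exp (-a) ^ 2 ≤ Real.exp (-a) := by
    have : Real.exp (-a) ≤ 1 := Real.exp_le_one_iff.2 (by linarith)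
    nlinarith [Real.exp_pos (-a)]
  set Ea := Real.exp (-a)
  set Eb := Real.exp (-b)
  set Eh := Real.exp (-(b/2))
  have hEa : 0 < Ea := Real.exp_pos _
  have hEb : 0 < Eb := Real.exp_pos _
  have hEh : 0 < Eh := Real.exp_pos _
  have f1 : 0 ≤ B * (Eb - Ea) := mul_nonneg hB0.le (by linarith)
  have f2 : B * (Eb - Ea) ≤ B * (q * (2 * Eh)) :=
    mul_le_mul_of_nonneg_left (e2.trans (mul_le_mul_of_nonneg_left e3 hq)) hB0.le
  have f3 : 0 ≤ (A - B) * Ea := mul_nonneg (by linarith) hEa.le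
  have f4 : (A - B) * Ea ≤ A * q * Ea := mul_le_mul_of_nonneg_right hAB hEa.le
  have g1 : (B * (Eb - Ea)) ^ 2 ≤ (B * (q * (2 * Eh))) ^ 2 := pow_le_pow_left₀ f1 f2 2
  have g2 : ((A - B) * Ea) ^ 2 ≤ (A * q * Ea) ^ 2 := pow_le_pow_left₀ f3 f4 2
  have k1 : (B * (q * (2 * Eh))) ^ 2 ≤ 4 * q ^ 2 * (1 / (τ + δ) * Eb) := by
    rw [show (B * (q * (2 * Eh))) ^ 2 = 4 * q ^ 2 * (B ^ 2 * Eh ^ 2) by ring, e4, hB2]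
    gcongr
  have k2 : (A * q * Ea) ^ 2 ≤ 4 * q ^ 2 * (1 / τ * Ea) := by
    rw [show (A * q * Ea) ^ 2 = q ^ 2 * (A ^ 2 * Ea ^ 2) by ring, hA2]
    have : 1 / (4 * Real.pi * τ) * Ea ^ 2 ≤ 1 / τ * Ea := by gcongr
    have h0 : 0 ≤ 1 / τ * Ea := by positivity
    have h1 := mul_le_mul_of_nonneg_left this (sq_nonneg q)
    have h2 := mul_nonneg (sq_nonneg q) h0
    linarith
  have hfin : (B * Eb - A * Ea) ^ 2 = 2 * ((B * (Eb - Ea)) ^ 2 + ((A - B) * Ea) ^ 2)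
      - (B * (Eb - Ea) + (A - B) * Ea) ^ 2 := by ring
  have h0 := sq_nonneg (B * (Eb - Ea) + (A - B) * Ea)
  rw [hfin]
  calc _ ≤ 2 * (4 * q ^ 2 * (1 / (τ + δ) * Eb) + 4 * q ^ 2 * (1 / τ * Ea)) := by linarith
    _ = _ := by ring

lemma exp_weight (lam σ M x u : ℝ) (hlam : 0 < lam) (hσ : 0 < σ) (hM : σ ≤ M) :
    Real.exp (-(x - u) ^ 2 / (4 * σ)) * Real.exp (lam * |u|) ≤
      Real.exp (2 * M * lam ^ 2) * Real.exp (lam * |x|) *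
        Real.exp (-(1 / (8 * σ)) * (x - u) ^ 2) := by
  rw [← Real.exp_add, ← Real.exp_add, ← Real.exp_add]
  apply Real.exp_le_exp.2
  have h1 : |u| ≤ |x| + |x - u| := by
    have := abs_sub_abs_le_abs_sub u x
    rw [abs_sub_comm] at this
    linarith
  have h2 : lam * |x - u| ≤ (x - u) ^ 2 / (8 * σ) + 2 * σ * lam ^ 2 := by
    rw [← sq_abs (x - u)]
    have : |x - u| ^ 2 / (8 * σ) + 2 * σ * lam ^ 2 - lam * |x - u|
        = (|x - u| - 4 * σ * lam) ^ 2 / (8 * σ) := by field_simp; ring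
    have h' : 0 ≤ (|x - u| - 4 * σ * lam) ^ 2 / (8 * σ) := by positivity
    linarith
  have h3 : -(x - u) ^ 2 / (4 * σ) = - ((x-u)^2 / (8 * σ)) - (x-u)^2 / (8 * σ) := by
    field_simp; ring
  have h4 : -(1 / (8 * σ)) * (x - u) ^ 2 = - ((x-u)^2 / (8 * σ)) := by ring
  rw [h3, h4]
  nlinarith [mul_le_mul_of_nonneg_left h1 hlam.le, mul_le_mul_of_nonneg_right hM (sq_nonneg lam)]

lemma gauss_shift (σ x : ℝ) (hσ : 0 < σ) :
    Integrable (fun u : ℝ => Real.exp (-(1 / (8 * σ)) * (x - u) ^ 2)) ∧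
    ∫ u : ℝ, Real.exp (-(1 / (8 * σ)) * (x - u) ^ 2) = Real.sqrt (8 * Real.pi) * Real.sqrt σ := by
  constructor
  · exact (integrable_exp_neg_mul_sq (b := 1 / (8 * σ)) (by positivity)).comp_sub_left x
  · rw [integral_sub_left_eq_self (fun y => Real.exp (-(1 / (8 * σ)) * y ^ 2)) volume x,
      integral_gaussian, ← Real.sqrt_mul (by positivity)]
    congr 1
    field_simp

lemma inner_bound (lam T τ δ x : ℝ) (hlam : 0 < lam) (hτ : 0 < τ) (hτT : τ ≤ T)
    (hδ : 0 ≤ δ) (hδ1 : δ ≤ 1) :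
    ∫ u : ℝ, (G (τ + δ) (x - u) - G τ (x - u)) ^ 2 * Real.exp (lam * |u|) ≤
      16 * Real.exp (2 * (T + 1) * lam ^ 2) * Real.sqrt (8 * Real.pi) * δ ^ 2 *
        Real.exp (lam * |x|) * τ ^ (-(5:ℝ) / 2) := by
  have hσ : 0 < τ + δ := by linarith
  obtain ⟨i1, v1⟩ := gauss_shift (τ + δ) x hσ
  obtain ⟨i2, v2⟩ := gauss_shift τ x hτ
  have i3 := ((i1.const_mul (1 / (τ + δ))).add (i2.const_mul (1 / τ))).const_mul
    (8 * (δ / τ) ^ 2 * (Real.exp (2 * (T + 1) * lam ^ 2) * Real.exp (lam * |x|)))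
  have key := integral_mono_of_nonneg (μ := volume)
    (f := fun u : ℝ => (G (τ + δ) (x - u) - G τ (x - u)) ^ 2 * Real.exp (lam * |u|))
    (ae_of_all _ fun u => by simp only [Pi.zero_apply]; positivity) i3
    (ae_of_all _ fun u => by
      have h := mul_le_mul_of_nonneg_right (G_diff_sq τ δ (x - u) hτ hδ)
        (Real.exp_pos (lam * |u|)).le
      have w1 := exp_weight lam (τ + δ) (T + 1) x u hlam hσ (by linarith)
      have w2 := exp_weight lam τ (T + 1) x u hlam hτ (by linarith)
      refine h.trans ?_
      have w3 := mul_le_mul_of_nonneg_left w1 (show 0 ≤ 1 / (τ + δ) by positivity)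
      have w4 := mul_le_mul_of_nonneg_left w2 (show 0 ≤ 1 / τ by positivity)
      have w5 := mul_le_mul_of_nonneg_left (add_le_add w3 w4)
        (show 0 ≤ 8 * (δ / τ) ^ 2 by positivity)
      simp only [Pi.add_apply]
      refine le_trans (le_of_eq ?_) (w5.trans (le_of_eq ?_)) <;> ring)
  refine key.trans ?_
  rw [integral_const_mul]
  simp only [Pi.add_apply]
  rw [integral_add (i1.const_mul _) (i2.const_mul _), integral_const_mul, integral_const_mul,
    v1, v2]
  have hs : ∀ y : ℝ, 0 < y → 1 / y * (Real.sqrt (8 * Real.pi) * Real.sqrt y)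
      = Real.sqrt (8 * Real.pi) * (1 / Real.sqrt y) := by
    intro y hy
    have : 0 < Real.sqrt y := Real.sqrt_pos.2 hy
    have h2 := Real.sq_sqrt hy.le
    field_simp
    rw [h2]
  rw [hs _ hσ, hs _ hτ]
  have hm : 1 / Real.sqrt (τ + δ) ≤ 1 / Real.sqrt τ :=
    one_div_le_one_div_of_le (Real.sqrt_pos.2 hτ) (Real.sqrt_le_sqrt (by linarith))
  have hp : τ ^ (-(5:ℝ) / 2) = (1 / τ ^ 2) * (1 / Real.sqrt τ) := by
    rw [show (-(5:ℝ) / 2) = -2 + -(1/2) by norm_num, Real.rpow_add hτ, Real.rpow_neg hτ.le,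
      Real.rpow_neg hτ.le, Real.sqrt_eq_rpow, one_div, one_div]
    norm_num
  rw [hp]
  calc _ ≤ 8 * (δ / τ) ^ 2 * (Real.exp (2 * (T + 1) * lam ^ 2) * Real.exp (lam * |x|)) *
        (Real.sqrt (8 * Real.pi) * (1 / Real.sqrt τ) +
          Real.sqrt (8 * Real.pi) * (1 / Real.sqrt τ)) := by gcongr
    _ = _ := by rw [div_pow]; ring

lemma outer_int (s t : ℝ) (hs : 0 ≤ s) (hst : s < t) :
    IntervalIntegrable (fun r : ℝ => (t - r) ^ (-(5:ℝ) / 2)) volume 0 s ∧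
    ∫ r in (0:ℝ)..s, (t - r) ^ (-(5:ℝ) / 2) ≤ (t - s) ^ (-(3:ℝ) / 2) := by
  constructor
  · apply ContinuousOn.intervalIntegrable
    rw [Set.uIcc_of_le hs]
    intro r hr
    apply ContinuousAt.continuousWithinAt
    apply ContinuousAt.rpow_const (by fun_prop)
    left
    have := hr.2
    intro h
    linarith
  · rw [intervalIntegral.integral_comp_sub_left (fun y => y ^ (-(5:ℝ) / 2)) t, integral_rpow]
    · rw [show (-(5:ℝ) / 2 + 1) = -(3:ℝ)/2 by norm_num, sub_zero]
      have h1 : 0 ≤ t ^ (-(3:ℝ) / 2) := Real.rpow_nonneg (by linarith) _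
      have h2 : 0 ≤ (t - s) ^ (-(3:ℝ) / 2) := Real.rpow_nonneg (by linarith) _
      linarith
    · right
      refine ⟨by norm_num, ?_⟩
      rw [Set.uIcc_of_le (by linarith)]
      intro h
      have := h.1
      linarith

/-- Heat-kernel estimate for temporal increments:
`∫₀ˢ ∫ (G_{t+δ−r}(x−u) − G_{t−r}(x−u))² e^{λ|u|} du dr ≤ C δ² (t−s)^{−3/2} e^{λ|x|}`. -/
theorem heat_kernel_temporal_increment_estimate (lam T : ℝ) (hlam : 0 < lam) (hT : 0 < T) :
    ∃ C : ℝ, ∀ δ s t x : ℝ, 0 ≤ δ → δ ≤ 1 → 0 ≤ s → s < t → t ≤ T →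
      (∫ r in (0:ℝ)..s, ∫ u : ℝ,
          (G (t + δ - r) (x - u) - G (t - r) (x - u)) ^ 2 * Real.exp (lam * |u|))
        ≤ C * δ ^ 2 * (t - s) ^ (-(3:ℝ) / 2) * Real.exp (lam * |x|) := by
  refine ⟨16 * Real.exp (2 * (T + 1) * lam ^ 2) * Real.sqrt (8 * Real.pi), ?_⟩
  intro δ s t x hδ hδ1 hs hst htT
  obtain ⟨i, v⟩ := outer_int s t hs hst
  set K := 16 * Real.exp (2 * (T + 1) * lam ^ 2) * Real.sqrt (8 * Real.pi) with hK
  have hK0 : 0 ≤ K := by positivity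
  have i' := (i.const_mul (K * δ ^ 2 * Real.exp (lam * |x|)))
  have key : (∫ r in (0:ℝ)..s, ∫ u : ℝ,
          (G (t + δ - r) (x - u) - G (t - r) (x - u)) ^ 2 * Real.exp (lam * |u|)) ≤
      ∫ r in (0:ℝ)..s, K * δ ^ 2 * Real.exp (lam * |x|) * (t - r) ^ (-(5:ℝ) / 2) := by
    rw [intervalIntegral.integral_of_le hs, intervalIntegral.integral_of_le hs]
    apply integral_mono_of_nonneg
    · exact ae_of_all _ fun r => integral_nonneg fun u => by
        simp only [Pi.zero_apply]; positivity
    · exact (intervalIntegrable_iff_integrableOn_Ioc_of_le hs).1 i'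
    · refine (ae_restrict_iff' measurableSet_Ioc).2 (ae_of_all _ fun r hr => ?_)
      have h := inner_bound lam T (t - r) δ x hlam (by linarith [hr.2]) (by linarith [hr.1]) hδ hδ1
      rw [show t - r + δ = t + δ - r by ring] at h
      exact h
  refine key.trans ?_
  rw [intervalIntegral.integral_const_mul]
  calc _ ≤ K * δ ^ 2 * Real.exp (lam * |x|) * (t - s) ^ (-(3:ℝ) / 2) :=
        mul_le_mul_of_nonneg_left v (by positivity)
    _ = _ := by ring
end
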